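/- arXiv:1510.02939 — 5 statements merged into one kernel-verified Lean document; each statement's English description precedes it below -/
import Mathlib

section
/- Fix n ≥ 2, positive integers K < P, and α ∈ [0,1], and set p(θ,α) = α(1 − q(θ)). Let χ_{n,i}(θ,α) be the indicator that node i is isolated in K∩G(n;θ,α), and let η_{12}(θ) be the indicator of the event K_1(θ) ∩ K_2(θ) ≠ ∅. Then E[χ_{n,1}(θ,α) χ_{n,2}(θ,α)] = E[(1 − α η_{12}(θ)) · Z(θ,α)^{n−2}], where Z(θ,α) = (1 − p(θ,α))² + α²·(v(θ; |K_1(θ) ∪ K_2(θ)|) − q(θ)²). -/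
open Filter Finset

noncomputable section

/-- Key rings: `K`-element subsets of a pool `{1,…,P}` of keys. -/
abbrev KeyRing (P K : ℕ) : Type := {S : Finset (Fin P) // S.card = K}

/-- Unordered node pairs, represented as ordered pairs `(i,j)` with `i < j`. -/
abbrev Pairs (n : ℕ) : Type := {e : Fin n × Fin n // e.1 < e.2}

/-- The number `C(P,K)` of possible key rings. -/
def numKR (P K : ℕ) : ℝ := (P.choose K : ℝ)

/-- Probability weight of a configuration `(κ, b)` under the product of the uniform
distribution on key rings (i.i.d. over the `n` nodes) and i.i.d. Bernoulli(α)
on/off link variables (one per unordered pair of nodes). -/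
def wt (n P K : ℕ) (α : ℝ) (κ : Fin n → KeyRing P K) (b : Pairs n → Bool) : ℝ :=
  (numKR P K)⁻¹ ^ n * ∏ e : Pairs n, (if b e then α else 1 - α)

/-- The on/off state of the channel between nodes `i` and `j`. -/
def link {n : ℕ} (b : Pairs n → Bool) (i j : Fin n) : Bool :=
  if h : i < j then b ⟨(i, j), h⟩
  else if h' : j < i then b ⟨(j, i), h'⟩
  else false

/-- Adjacency in the intersection graph `K ∩ G(n; θ, α)`:  the key rings of `i` and `j`
intersect and the channel between them is on. -/
abbrev Adj {n P K : ℕ} (κ : Fin n → KeyRing P K) (b : Pairs n → Bool) (i j : Fin n) : Prop :=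
  i ≠ j ∧ ((κ i).1 ∩ (κ j).1).Nonempty ∧ link b i j = true

/-- Node `i` is isolated: it is adjacent to no other node. -/
abbrev Isolated {n P K : ℕ} (κ : Fin n → KeyRing P K) (b : Pairs n → Bool) (i : Fin n) : Prop :=
  ∀ j, ¬ Adj κ b i j

/-- `P_n(θ,α)`: probability that `K ∩ G(n; θ, α)` contains no isolated nodes. -/
def probNoIsolated (n P K : ℕ) (α : ℝ) : ℝ :=
  ∑ κ : Fin n → KeyRing P K, ∑ b : Pairs n → Bool,
    wt n P K α κ b * (if ∀ i, ¬ Isolated κ b i then 1 else 0)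

/-- Number of isolated nodes in the configuration `(κ, b)`. -/
def numIsolated {n P K : ℕ} (κ : Fin n → KeyRing P K) (b : Pairs n → Bool) : ℕ :=
  (Finset.univ.filter fun i => Isolated κ b i).card

/-- `E[I_n(θ,α)]`: expected number of isolated nodes in `K ∩ G(n; θ, α)`. -/
def expIsolated (n P K : ℕ) (α : ℝ) : ℝ :=
  ∑ κ : Fin n → KeyRing P K, ∑ b : Pairs n → Bool,
    wt n P K α κ b * (numIsolated κ b : ℝ)

/-- `q(θ) = C(P−K,K)/C(P,K)` if `2K ≤ P`, and `0` otherwise. -/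
def q (K P : ℕ) : ℝ :=
  if 2 * K ≤ P then ((P - K).choose K : ℝ) / (P.choose K : ℝ) else 0

/-- `v(θ;r) = C(P−r,K)/C(P,K)` if `r ≤ P−K`, and `0` otherwise. -/
def v (K P r : ℕ) : ℝ :=
  if r ≤ P - K then ((P - r).choose K : ℝ) / (P.choose K : ℝ) else 0

end


lemma choose_div_eq (K P r : ℕ) (hK : 0 < K) (hKP : K < P) :
    v K P r = ((P - r).choose K : ℝ) / (P.choose K : ℝ) := by
  unfold v
  split_ifs with h
  · rfl
  · rw [Nat.choose_eq_zero_of_lt (by omega)]; simp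

lemma q_eq_v (K P : ℕ) (hK : 0 < K) (hKP : K < P) : q K P = v K P K := by
  rw [choose_div_eq K P K hK hKP]
  unfold q
  split_ifs with h
  · rfl
  · rw [Nat.choose_eq_zero_of_lt (by omega)]; simp

lemma sum_disj (K P : ℕ) (hK : 0 < K) (hKP : K < P) (T : Finset (Fin P)) :
    ∑ S : KeyRing P K, (numKR P K)⁻¹ * (if (T ∩ S.1).Nonempty then (0 : ℝ) else 1)
      = v K P T.card := by
  have h1 : ∑ S : KeyRing P K, (if (T ∩ S.1).Nonempty then (0 : ℝ) else 1)
      = ((powersetCard K Tᶜ).card : ℝ) := by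
    have h2 : ∑ S : KeyRing P K, (if (T ∩ S.1).Nonempty then (0 : ℝ) else 1)
        = ∑ S ∈ powersetCard K (univ : Finset (Fin P)),
          (if (T ∩ S).Nonempty then (0 : ℝ) else 1) := by
      refine (Finset.sum_subtype _ (fun x => ?_) (fun S : Finset (Fin P) =>
        (if (T ∩ S).Nonempty then (0 : ℝ) else 1))).symm
      simp [mem_powersetCard]
    have h3 : ∑ S ∈ powersetCard K (univ : Finset (Fin P)),
          (if (T ∩ S).Nonempty then (0 : ℝ) else 1)
        = ∑ S ∈ powersetCard K (univ : Finset (Fin P)),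
          (if ¬ (T ∩ S).Nonempty then (1 : ℝ) else 0) :=
      Finset.sum_congr rfl (fun S _ => (ite_not _ _ _).symm)
    rw [h2, h3, ← Finset.sum_filter, Finset.sum_const, nsmul_eq_mul, mul_one]
    congr 2
    ext S
    simp only [mem_filter, mem_powersetCard, Finset.not_nonempty_iff_eq_empty,
      ← Finset.disjoint_iff_inter_eq_empty, Finset.subset_compl_iff_disjoint_left]
    simp [and_comm]
  rw [← Finset.mul_sum, h1, card_powersetCard, card_compl, Fintype.card_fin,
    choose_div_eq K P _ hK hKP, numKR]
  ring

lemma sum_one (K P : ℕ) (hK : 0 < K) (hKP : K < P) :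
    ∑ _S : KeyRing P K, (numKR P K)⁻¹ = 1 := by
  have := sum_disj K P hK hKP ∅
  have hc : (P.choose K : ℝ) ≠ 0 := by
    exact_mod_cast (Nat.choose_pos hKP.le).ne'
  simpa [choose_div_eq K P _ hK hKP, hc] using this

/-- Probability that a given pair is not an edge. -/
noncomputable def nadj {P K : ℕ} (α : ℝ) (S T : KeyRing P K) : ℝ :=
  if (S.1 ∩ T.1).Nonempty then 1 - α else 1

lemma sum_node (K P : ℕ) (hK : 0 < K) (hKP : K < P) (α : ℝ) (S₁ S₂ : KeyRing P K) :
    ∑ S : KeyRing P K, (numKR P K)⁻¹ * (nadj α S₁ S * nadj α S₂ S)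
      = (1 - α * (1 - q K P)) ^ 2
              + α ^ 2 * (v K P (S₁.1 ∪ S₂.1).card - q K P ^ 2) := by
  have e : ∀ S : KeyRing P K, (numKR P K)⁻¹ * (nadj α S₁ S * nadj α S₂ S)
      = (1 - α) ^ 2 * (numKR P K)⁻¹
        + (1 - α) * α * ((numKR P K)⁻¹ * (if (S₁.1 ∩ S.1).Nonempty then (0 : ℝ) else 1))
        + (1 - α) * α * ((numKR P K)⁻¹ * (if (S₂.1 ∩ S.1).Nonempty then (0 : ℝ) else 1))
        + α ^ 2 * ((numKR P K)⁻¹ *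
          (if ((S₁.1 ∪ S₂.1) ∩ S.1).Nonempty then (0 : ℝ) else 1)) := by
    intro S
    simp only [Finset.union_inter_distrib_right, Finset.union_nonempty]
    unfold nadj
    by_cases h1 : (S₁.1 ∩ S.1).Nonempty <;> by_cases h2 : (S₂.1 ∩ S.1).Nonempty <;>
      simp only [h1, h2, if_true, if_false, or_true, true_or, or_self] <;> ring
  rw [Finset.sum_congr rfl (fun S _ => e S)]
  rw [Finset.sum_add_distrib, Finset.sum_add_distrib, Finset.sum_add_distrib,
    ← Finset.mul_sum univ _ ((1 - α) ^ 2), ← Finset.mul_sum univ _ ((1 - α) * α),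
    ← Finset.mul_sum univ _ ((1 - α) * α), ← Finset.mul_sum univ _ (α ^ 2),
    sum_disj K P hK hKP, sum_disj K P hK hKP, sum_disj K P hK hKP, sum_one K P hK hKP, S₁.2, S₂.2,
    q_eq_v K P hK hKP]
  ring

lemma isolated_ind {m P K : ℕ} (κ : Fin (m+2) → KeyRing P K) (b : Pairs (m+2) → Bool) :
    ((if Isolated κ b 0 then (1 : ℝ) else 0) * (if Isolated κ b 1 then (1 : ℝ) else 0))
     = ∏ e : Pairs (m+2),
        (if e.1.1 ≤ 1 ∧ ((κ e.1.1).1 ∩ (κ e.1.2).1).Nonempty ∧ b e = true then 0 else 1) := by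
  have key : (Isolated κ b 0 ∧ Isolated κ b 1) ↔ ∀ e : Pairs (m+2),
      ¬ (e.1.1 ≤ 1 ∧ ((κ e.1.1).1 ∩ (κ e.1.2).1).Nonempty ∧ b e = true) := by
    constructor
    · rintro ⟨h0, h1⟩ ⟨⟨i, j⟩, hij⟩ ⟨hi, hne, hb⟩
      simp only at hij hi hne hb
      have hi' : i = 0 ∨ i = 1 := by
        simp only [Fin.le_def, Fin.ext_iff, Fin.val_zero, Fin.val_one] at hi ⊢
        omega
      rcases hi' with rfl | rfl
      · exact h0 j ⟨hij.ne, hne, by simp [link, hij, hb]⟩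
      · exact h1 j ⟨hij.ne, hne, by simp [link, hij, hb]⟩
    · intro h
      have aux : ∀ i : Fin (m+2), i ≤ 1 → Isolated κ b i := by
        rintro i hi j ⟨hij, hne, hl⟩
        unfold link at hl
        split_ifs at hl with h1 h2
        · exact h ⟨(i, j), h1⟩ ⟨hi, hne, hl⟩
        · exact h ⟨(j, i), h2⟩ ⟨h2.le.trans hi, by rwa [Finset.inter_comm], hl⟩
      exact ⟨aux 0 (Fin.zero_le _), aux 1 le_rfl⟩
  by_cases H : Isolated κ b 0 ∧ Isolated κ b 1
  · rw [if_pos H.1, if_pos H.2, Finset.prod_congr rfl (fun e _ => if_neg (key.1 H e))]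
    simp
  · have H' := H
    rw [key] at H
    push Not at H
    obtain ⟨e, he⟩ := H
    have hz : ∏ e : Pairs (m+2), (if e.1.1 ≤ 1 ∧
        ((κ e.1.1).1 ∩ (κ e.1.2).1).Nonempty ∧ b e = true then (0 : ℝ) else 1) = 0 := by
      apply Finset.prod_eq_zero (Finset.mem_univ e)
      exact if_pos he
    rw [hz]
    rw [not_and_or] at H'
    rcases H' with h | h <;> simp only [if_neg h, zero_mul, mul_zero]

lemma prod_pairs {m : ℕ} (f : Fin (m+2) → Fin (m+2) → ℝ) :
    ∏ e : Pairs (m+2), (if e.1.1 ≤ 1 then f e.1.1 e.1.2 else 1)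
      = f 0 1 * ∏ j : Fin m, (f 0 j.succ.succ * f 1 j.succ.succ) := by
  have h1 : ∏ e : Pairs (m+2), (if e.1.1 ≤ 1 then f e.1.1 e.1.2 else 1)
      = ∏ e ∈ (univ : Finset (Fin (m+2) × Fin (m+2))).filter (fun e => e.1 < e.2),
          (if e.1 ≤ 1 then f e.1 e.2 else 1) := by
    refine (Finset.prod_subtype _ (fun x => ?_) (fun e : Fin (m+2) × Fin (m+2) => 
      (if e.1 ≤ 1 then f e.1 e.2 else 1))).symm
    simp
  rw [h1, Finset.prod_filter, Fintype.prod_prod_type,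
    Fin.prod_univ_succ]
  have h2 : ∀ i : Fin m, ∏ j : Fin (m+2), (if i.succ.succ < j then
      (if i.succ.succ ≤ 1 then f i.succ.succ j else 1) else 1) = 1 := by
    intro i
    refine Finset.prod_eq_one (fun j _ => ?_)
    have : ¬ (i.succ.succ ≤ (1 : Fin (m+2))) := by
      simp [Fin.le_def]
    simp [this]
  dsimp only
  rw [Fin.prod_univ_succ (n := m) (f := fun i => ∏ y : Fin (m+2), _), Finset.prod_congr rfl (fun i _ => h2 i)]
  simp only [Fin.prod_univ_succ (n := m+1), Fin.prod_univ_succ (n := m)]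
  simp [Finset.prod_mul_distrib, Fin.lt_def, Fin.le_def, mul_assoc]

lemma sum_b {m P K : ℕ} (α : ℝ) (κ : Fin (m+2) → KeyRing P K) :
    ∑ b : Pairs (m+2) → Bool, wt (m+2) P K α κ b *
       ((if Isolated κ b 0 then (1 : ℝ) else 0) * (if Isolated κ b 1 then (1 : ℝ) else 0))
     = (numKR P K)⁻¹ ^ (m+2) * (nadj α (κ 0) (κ 1) *
        ∏ j : Fin m, (nadj α (κ 0) (κ j.succ.succ) * nadj α (κ 1) (κ j.succ.succ))) := by
  rw [← prod_pairs (fun i j => nadj α (κ i) (κ j))]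
  simp only [isolated_ind, wt, mul_assoc, ← Finset.mul_sum, ← Finset.prod_mul_distrib]
  congr 1
  rw [← Fintype.prod_sum (fun (e : Pairs (m+2)) (x : Bool) => (if x = true then α else 1 - α) *
    (if e.1.1 ≤ 1 ∧ ((κ e.1.1).1 ∩ (κ e.1.2).1).Nonempty ∧ x = true then (0:ℝ) else 1))]
  refine Finset.prod_congr rfl (fun e _ => ?_)
  rw [Fintype.sum_bool]
  unfold nadj
  by_cases h1 : e.1.1 ≤ 1 <;> by_cases h2 : ((κ e.1.1).1 ∩ (κ e.1.2).1).Nonempty <;>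
    simp [h1, h2]

lemma sum_fin_cons {X : Type*} [Fintype X] {m : ℕ} (F : (Fin (m+1) → X) → ℝ) :
    ∑ κ, F κ = ∑ x : X, ∑ κ : Fin m → X, F (Fin.cons x κ) := by
  rw [← Fintype.sum_prod_type' (fun x κ => F (Fin.cons x κ))]
  exact (Fintype.sum_equiv (Fin.consEquiv (fun _ => X)) _ _ (fun _ => rfl)).symm

/-- `E[χ_{n,1}(θ,α) χ_{n,2}(θ,α)] = E[(1 - α η_{12}(θ)) Z(θ,α)^{n-2}]` where
`χ_{n,i}` is the indicator that node `i` is isolated in `K ∩ G(n;θ,α)`,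
`η_{12}` is the indicator of `K_1(θ) ∩ K_2(θ) ≠ ∅`, and
`Z(θ,α) = (1-p(θ,α))² + α² (v(θ;|K_1(θ) ∪ K_2(θ)|) - q(θ)²)` with
`p(θ,α) = α(1 - q(θ))`. -/
theorem crossMoment_formula
    (n K P : ℕ) (α : ℝ) (hn : 2 ≤ n) (hK : 0 < K) (hKP : K < P)
    (hα : 0 ≤ α ∧ α ≤ 1) :
    (∑ κ : Fin n → KeyRing P K, ∑ b : Pairs n → Bool,
        wt n P K α κ b *
          ((if Isolated κ b ⟨0, by omega⟩ then (1 : ℝ) else 0) *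
            (if Isolated κ b ⟨1, by omega⟩ then (1 : ℝ) else 0)))
      =
    ∑ S₁ : KeyRing P K, ∑ S₂ : KeyRing P K,
      (numKR P K)⁻¹ * (numKR P K)⁻¹ *
        ((1 - α * (if (S₁.1 ∩ S₂.1).Nonempty then (1 : ℝ) else 0)) *
          ((1 - α * (1 - q K P)) ^ 2
              + α ^ 2 * (v K P (S₁.1 ∪ S₂.1).card - q K P ^ 2)) ^ (n - 2)) := by
  obtain ⟨m, rfl⟩ : ∃ m, n = m + 2 := ⟨n - 2, by omega⟩
  refine (Finset.sum_congr rfl (fun κ _ => sum_b α κ)).trans ?_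
  rw [sum_fin_cons]
  refine Finset.sum_congr rfl (fun S₁ _ => ?_)
  rw [sum_fin_cons]
  refine Finset.sum_congr rfl (fun S₂ _ => ?_)
  rw [← sum_node K P hK hKP α S₁ S₂, Nat.add_sub_cancel, ← Fin.prod_const m (∑ S : KeyRing P K, _),
    Fintype.prod_sum,
    Finset.mul_sum, Finset.mul_sum]
  refine Finset.sum_congr rfl (fun κ _ => ?_)
  have h1 : (1 : Fin (m+2)) = Fin.succ 0 := rfl
  rw [h1]
  simp only [Fin.cons_zero, Fin.cons_succ]
  rw [Finset.prod_mul_distrib (f := fun _ => (numKR P K)⁻¹), Fin.prod_const]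
  have h2 : (1 - α * (if (S₁.1 ∩ S₂.1).Nonempty then (1 : ℝ) else 0)) = nadj α S₁ S₂ := by
    unfold nadj
    split_ifs <;> ring
  rw [h2]
  ring
end

section
/- Fix n ≥ 2, positive integers K < P, and α ∈ [0,1] with p(θ,α) = α(1 − q(θ)) < 1. Let η_{12}(θ) be the indicator of the event K_1(θ) ∩ K_2(θ) ≠ ∅, and set Z̃(θ,α) = α²·(v(θ; |K_1(θ) ∪ K_2(θ)|) − q(θ)²)/(1 − p(θ,α))². Then E[(1 − η_{12}(θ))(1 + Z̃(θ,α))^{n−2}] = q(θ)·(1 + α²(v(θ;2K) − q(θ)²)/(1 − p(θ,α))²)^{n−2}, and this quantity is at most q(θ). -/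
open Filter Finset

noncomputable section

lemma choose_logconcave_aux (K P : ℕ) :
    (P - 2 * K).choose K * P.choose K ≤ (P - K).choose K * (P - K).choose K := by
  have h : (P - 2 * K).descFactorial K * P.descFactorial K
      ≤ (P - K).descFactorial K * (P - K).descFactorial K := by
    simp only [Nat.descFactorial_eq_prod_range, ← Finset.prod_mul_distrib]
    apply Finset.prod_le_prod'
    intro i _
    rcases le_total (P - 2 * K) i with h | h
    · rw [Nat.sub_eq_zero_of_le h, zero_mul]
      exact Nat.zero_le _
    · by_cases h2 : 2 * K ≤ P
      · obtain ⟨a, ha⟩ : ∃ a, P = a + 2 * K + i := ⟨P - 2 * K - i, by omega⟩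
        have e1 : P - 2 * K - i = a := by omega
        have e2 : P - i = a + 2 * K := by omega
        have e3 : P - K - i = a + K := by omega
        rw [e1, e2, e3]
        nlinarith [Nat.zero_le (K * K)]
      · have : P - 2 * K - i = 0 := by omega
        rw [this, zero_mul]
        exact Nat.zero_le _
  simp only [Nat.descFactorial_eq_factorial_mul_choose] at h
  have hpos : 0 < K.factorial * K.factorial := by positivity
  refine Nat.le_of_mul_le_mul_left ?_ hpos
  calc _ = _ := by ring
    _ ≤ _ := h
    _ = _ := by ring

lemma sum_keyRing_aux (K P : ℕ) (f : Finset (Fin P) → ℝ) :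
    ∑ S : KeyRing P K, f S.1 = ∑ S ∈ Finset.powersetCard K Finset.univ, f S := by
  symm
  apply Finset.sum_subtype
  intro x
  simp

lemma q_eq_aux (K P : ℕ) (hK : 0 < K) (hKP : K < P) :
    q K P = ((P - K).choose K : ℝ) / (P.choose K : ℝ) := by
  unfold q
  split_ifs with h
  · rfl
  · rw [Nat.choose_eq_zero_of_lt (by omega)]; simp

lemma inner_aux (K P : ℕ) (S : Finset (Fin P)) (hS : S.card = K) (c : ℝ) (g : ℕ → ℝ) :
    ∑ T : KeyRing P K, c * ((1 - (if (S ∩ T.1).Nonempty then (1 : ℝ) else 0)) *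
      g (S ∪ T.1).card) = ((P - K).choose K : ℝ) * (c * g (2 * K)) := by
  rw [sum_keyRing_aux K P (fun T => c * ((1 - (if (S ∩ T).Nonempty then (1 : ℝ) else 0)) *
      g (S ∪ T).card))]
  have hsub : Finset.powersetCard K Sᶜ ⊆ Finset.powersetCard K (Finset.univ : Finset (Fin P)) :=
    Finset.powersetCard_mono (Finset.subset_univ _)
  rw [← Finset.sum_subset hsub]
  · have : ∀ T ∈ Finset.powersetCard K Sᶜ,
        c * ((1 - (if (S ∩ T).Nonempty then (1 : ℝ) else 0)) * g (S ∪ T).card)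
          = c * g (2 * K) := by
      intro T hT
      rw [Finset.mem_powersetCard] at hT
      have hd : Disjoint S T := by
        rw [disjoint_comm]; exact Finset.subset_compl_iff_disjoint_right.mp hT.1
      rw [Finset.card_union_of_disjoint hd, hS, hT.2,
        if_neg (by rw [Finset.not_nonempty_iff_eq_empty]; exact Finset.disjoint_iff_inter_eq_empty.mp hd)]
      rw [two_mul]; ring
    rw [Finset.sum_congr rfl this, Finset.sum_const, Finset.card_powersetCard,
      Finset.card_compl, hS, Fintype.card_fin, nsmul_eq_mul]
  · intro T hT hT2
    have : (S ∩ T).Nonempty := by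
      rw [Finset.mem_powersetCard] at hT hT2
      by_contra hne
      rw [Finset.not_nonempty_iff_eq_empty, ← Finset.disjoint_iff_inter_eq_empty] at hne
      exact hT2 ⟨Finset.subset_compl_iff_disjoint_right.mpr hne.symm, hT.2⟩
    rw [if_pos this]; simp

/-- With `p(θ,α) = α(1-q(θ)) < 1`, `η_{12}` the indicator of `K_1(θ) ∩ K_2(θ) ≠ ∅`,
and `Z̃(θ,α) = α² (v(θ;|K_1(θ) ∪ K_2(θ)|) - q(θ)²)/(1-p(θ,α))²`:
`E[(1-η_{12})(1+Z̃)^{n-2}] = q(θ) (1 + α²(v(θ;2K) - q(θ)²)/(1-p(θ,α))²)^{n-2}`,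
and this quantity is at most `q(θ)`. -/
theorem first_term_formula_and_bound
    (n K P : ℕ) (α : ℝ) (hn : 2 ≤ n) (hK : 0 < K) (hKP : K < P)
    (hα : 0 ≤ α ∧ α ≤ 1) (hp : α * (1 - q K P) < 1) :
    (∑ S₁ : KeyRing P K, ∑ S₂ : KeyRing P K,
        (numKR P K)⁻¹ * (numKR P K)⁻¹ *
          ((1 - (if (S₁.1 ∩ S₂.1).Nonempty then (1 : ℝ) else 0)) *
            (1 + α ^ 2 * (v K P (S₁.1 ∪ S₂.1).card - q K P ^ 2)
                / (1 - α * (1 - q K P)) ^ 2) ^ (n - 2)))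
      = q K P * (1 + α ^ 2 * (v K P (2 * K) - q K P ^ 2)
                / (1 - α * (1 - q K P)) ^ 2) ^ (n - 2) ∧
    q K P * (1 + α ^ 2 * (v K P (2 * K) - q K P ^ 2)
                / (1 - α * (1 - q K P)) ^ 2) ^ (n - 2) ≤ q K P := by
  have hC : (0 : ℝ) < (P.choose K : ℝ) := by exact_mod_cast Nat.choose_pos hKP.le
  have hq0 : 0 ≤ q K P := by rw [q_eq_aux K P hK hKP]; positivity
  constructor
  · have hin : ∀ S₁ : KeyRing P K, _ := fun S₁ => inner_aux K P S₁.1 S₁.2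
      ((numKR P K)⁻¹ * (numKR P K)⁻¹)
      (fun r => (1 + α ^ 2 * (v K P r - q K P ^ 2) / (1 - α * (1 - q K P)) ^ 2) ^ (n - 2))
    rw [Finset.sum_congr rfl (fun S₁ _ => hin S₁)]
    rw [Finset.sum_const, Finset.card_univ, Fintype.card_finset_len, Fintype.card_fin,
      nsmul_eq_mul]
    generalize hX : (1 + α ^ 2 * (v K P (2 * K) - q K P ^ 2) / (1 - α * (1 - q K P)) ^ 2)
      ^ (n - 2) = X
    rw [q_eq_aux K P hK hKP, numKR]
    field_simp
  · have hv0 : 0 ≤ v K P (2 * K) := by unfold v; split_ifs <;> positivity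
    have hv : v K P (2 * K) ≤ q K P ^ 2 := by
      unfold v
      split_ifs
      · rw [q_eq_aux K P hK hKP, div_pow, div_le_div_iff₀ hC (by positivity)]
        have h : ((P - 2 * K).choose K : ℝ) * P.choose K
            ≤ (P - K).choose K * (P - K).choose K := by
          exact_mod_cast choose_logconcave_aux K P
        nlinarith [mul_le_mul_of_nonneg_right h hC.le]
      · positivity
    have hd : 0 < 1 - α * (1 - q K P) := by linarith
    have hd2 : 0 < (1 - α * (1 - q K P)) ^ 2 := by positivity
    refine mul_le_of_le_one_right hq0 (pow_le_one₀ ?_ ?_)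
    · have haq : (α * q K P) ^ 2 ≤ (1 - α * (1 - q K P)) ^ 2 :=
        pow_le_pow_left₀ (mul_nonneg hα.1 hq0) (by nlinarith [hα.2]) 2
      have : -1 ≤ α ^ 2 * (v K P (2 * K) - q K P ^ 2) / (1 - α * (1 - q K P)) ^ 2 := by
        rw [le_div_iff₀ hd2]
        nlinarith [mul_nonneg (sq_nonneg α) hv0]
      linarith
    · have : α ^ 2 * (v K P (2 * K) - q K P ^ 2) / (1 - α * (1 - q K P)) ^ 2 ≤ 0 :=
        div_nonpos_of_nonpos_of_nonneg
          (mul_nonpos_of_nonneg_of_nonpos (sq_nonneg α) (by linarith)) hd2.le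
      linarith
end
end

section
/- Fix n ≥ 2, positive integers K < P, and α ∈ [0,1] with p(θ,α) = α(1 − q(θ)) < 1. Let η_{12}(θ) be the indicator of the event K_1(θ) ∩ K_2(θ) ≠ ∅, and set Z̃(θ,α) = α²·(v(θ; |K_1(θ) ∪ K_2(θ)|) − q(θ)²)/(1 − p(θ,α))². Then (1−α)·E[η_{12}(θ)(1 + Z̃(θ,α))^{n−2}] ≤ (1−α)(1−q(θ))·exp((n−2)·α q(θ) p(θ,α)/(1 − p(θ,α))²). -/
open Filter Finset

noncomputable section

theorem q_eq (K P : ℕ) : q K P = ((P - K).choose K : ℝ) / (P.choose K : ℝ) := by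
  unfold q
  split_ifs with h
  · rfl
  · rw [Nat.choose_eq_zero_of_lt (by omega : P - K < K)]; simp

theorem v_nonneg (K P r : ℕ) : 0 ≤ v K P r := by
  unfold v
  split_ifs <;> positivity

theorem v_le_q (K P r : ℕ) (h : K ≤ r) : v K P r ≤ q K P := by
  rw [q_eq]
  unfold v
  split_ifs
  · have : (P - r).choose K ≤ (P - K).choose K := Nat.choose_le_choose K (by omega)
    gcongr
  · positivity

theorem count_disj (K P : ℕ) (S : KeyRing P K) :
    ∑ T : KeyRing P K, (if (S.1 ∩ T.1).Nonempty then (1 : ℝ) else 0)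
      = (P.choose K : ℝ) - ((P - K).choose K : ℝ) := by
  have h1 : ∑ T : KeyRing P K, (if (S.1 ∩ T.1).Nonempty then (1 : ℝ) else 0)
      = ∑ T ∈ powersetCard K (univ : Finset (Fin P)),
          (if (S.1 ∩ T).Nonempty then (1 : ℝ) else 0) := by
    symm
    apply Finset.sum_subtype
    intro x
    simp [mem_powersetCard]
  have h2 : ∀ T : Finset (Fin P), (if (S.1 ∩ T).Nonempty then (1 : ℝ) else 0)
      = 1 - (if T ⊆ S.1ᶜ then (1 : ℝ) else 0) := by
    intro T
    have : (S.1 ∩ T).Nonempty ↔ ¬ T ⊆ S.1ᶜ := by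
      rw [Finset.subset_compl_iff_disjoint_left, Finset.disjoint_iff_inter_eq_empty,
        Finset.nonempty_iff_ne_empty]
    by_cases h : T ⊆ S.1ᶜ <;> simp [this, h]
  have h3 : (powersetCard K (univ : Finset (Fin P))).filter (fun T => T ⊆ S.1ᶜ)
      = powersetCard K S.1ᶜ := by
    ext T
    simp [mem_powersetCard, and_comm]
  rw [h1, Finset.sum_congr rfl (fun T _ => h2 T), Finset.sum_sub_distrib, Finset.sum_boole, h3]
  simp [card_powersetCard, card_compl, S.2]

/-- With `p(θ,α) = α(1-q(θ)) < 1`, `η_{12}` the indicator of `K_1(θ) ∩ K_2(θ) ≠ ∅`,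
and `Z̃(θ,α) = α² (v(θ;|K_1(θ) ∪ K_2(θ)|) - q(θ)²)/(1-p(θ,α))²`:
`(1-α) E[η_{12} (1+Z̃)^{n-2}]
   ≤ (1-α)(1-q(θ)) exp((n-2) α q(θ) p(θ,α)/(1-p(θ,α))²)`. -/
theorem second_term_bound
    (n K P : ℕ) (α : ℝ) (hn : 2 ≤ n) (hK : 0 < K) (hKP : K < P)
    (hα : 0 ≤ α ∧ α ≤ 1) (hp : α * (1 - q K P) < 1) :
    (1 - α) *
      (∑ S₁ : KeyRing P K, ∑ S₂ : KeyRing P K,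
        (numKR P K)⁻¹ * (numKR P K)⁻¹ *
          ((if (S₁.1 ∩ S₂.1).Nonempty then (1 : ℝ) else 0) *
            (1 + α ^ 2 * (v K P (S₁.1 ∪ S₂.1).card - q K P ^ 2)
                / (1 - α * (1 - q K P)) ^ 2) ^ (n - 2)))
      ≤ (1 - α) * (1 - q K P) *
          Real.exp (((n : ℝ) - 2) * (α * q K P * (α * (1 - q K P)))
              / (1 - α * (1 - q K P)) ^ 2) := by
  obtain ⟨h0, h1⟩ := hα
  have hc : (0 : ℝ) < (P.choose K : ℝ) := by exact_mod_cast Nat.choose_pos hKP.le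
  have hq0 : 0 ≤ q K P := by rw [q_eq]; positivity
  set Q := q K P with hQ
  have hd : 0 < 1 - α * (1 - Q) := by linarith
  set D := 1 - α * (1 - Q) with hD
  set m := n - 2 with hm
  have hmn : (n : ℝ) - 2 = (m : ℝ) := by rw [hm, Nat.cast_sub hn]; norm_num
  rw [hmn]
  set B := α * Q * (α * (1 - Q)) / D ^ 2 with hB
  have hexp : (m : ℝ) * (α * Q * (α * (1 - Q))) / D ^ 2 = (m : ℝ) * B := by
    rw [hB]; ring
  rw [hexp, mul_assoc]
  refine mul_le_mul_of_nonneg_left ?_ (by linarith)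
  have key : ∀ S T : KeyRing P K,
      (1 + α ^ 2 * (v K P (S.1 ∪ T.1).card - Q ^ 2) / D ^ 2) ^ m ≤ Real.exp (m * B) := by
    intro S T
    have hv0 := v_nonneg K P (S.1 ∪ T.1).card
    have hv1 : v K P (S.1 ∪ T.1).card ≤ Q := by
      apply v_le_q
      calc K = S.1.card := S.2.symm
        _ ≤ _ := Finset.card_le_card Finset.subset_union_left
    set V := v K P (S.1 ∪ T.1).card
    have hD2 : 0 < D ^ 2 := by positivity
    have ha : 0 ≤ 1 + α ^ 2 * (V - Q ^ 2) / D ^ 2 := by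
      have hle : α * Q ≤ D := by rw [hD]; linarith
      have hsq : (α * Q) ^ 2 ≤ D ^ 2 := pow_le_pow_left₀ (by positivity) hle 2
      have h5 : 0 ≤ α ^ 2 * V := by positivity
      have h4 : 1 + α ^ 2 * (V - Q ^ 2) / D ^ 2 = (D ^ 2 + α ^ 2 * (V - Q ^ 2)) / D ^ 2 := by
        field_simp
      rw [h4]
      apply div_nonneg _ hD2.le
      nlinarith
    have hb : α ^ 2 * (V - Q ^ 2) / D ^ 2 ≤ B := by
      rw [hB]
      apply div_le_div_of_nonneg_right _ hD2.le
      have : 0 ≤ α ^ 2 * (Q - V) := mul_nonneg (by positivity) (by linarith)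
      nlinarith
    rw [Real.exp_nat_mul]
    apply pow_le_pow_left₀ ha
    have := Real.add_one_le_exp B
    linarith
  calc _ ≤ ∑ S : KeyRing P K, ∑ T : KeyRing P K, (numKR P K)⁻¹ * (numKR P K)⁻¹ *
          ((if (S.1 ∩ T.1).Nonempty then (1 : ℝ) else 0) * Real.exp (m * B)) := by
        refine Finset.sum_le_sum fun S _ => Finset.sum_le_sum fun T _ => ?_
        refine mul_le_mul_of_nonneg_left ?_ (mul_self_nonneg _)
        refine mul_le_mul_of_nonneg_left (key S T) ?_
        split_ifs <;> norm_num
    _ = (1 - Q) * Real.exp (m * B) := by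
        simp_rw [← Finset.mul_sum, ← Finset.sum_mul, count_disj]
        have hcard : Fintype.card (KeyRing P K) = P.choose K := by
          simp [KeyRing, Fintype.card_finset_len]
        rw [Finset.sum_const, Finset.card_univ, hcard, hQ, q_eq, numKR, nsmul_eq_mul]
        field_simp
end
end

section
/- Let α_n ∈ [0,1] and q_n ∈ [0,1] (n ≥ 2) be sequences such that p_n := α_n(1 − q_n) = (log n + γ_n)/n for all n, where γ_n is a real sequence with lim_{n→∞} γ_n = −∞. Define R°_n = exp(α_n (log n)/(1 − p_n)²). If k ↦ n_k is a nondecreasing subsequence with n_k → ∞ along which the limit lim_{k→∞} α_{n_k} log n_k exists and lies in (0,∞), then lim_{k→∞} q_{n_k} = 1 and lim_{k→∞} (1 − q_{n_k}) R°_{n_k} = 0; consequently lim_{k→∞} (q_{n_k} + (1 − q_{n_k}) R°_{n_k}) = 1. -/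
open Filter

/-- Lemma 3: suppose `p_n := α_n (1 - q_n) = (log n + γ_n)/n` with `γ_n → -∞`, and
let `R°_n = exp(α_n log n/(1-p_n)²)`.  Along any nondecreasing subsequence
`k ↦ n_k → ∞` for which `lim_k α_{n_k} log n_k` exists in `(0,∞)`, one has
`q_{n_k} → 1`, `(1 - q_{n_k}) R°_{n_k} → 0`, and hence
`q_{n_k} + (1 - q_{n_k}) R°_{n_k} → 1`. -/
theorem subseq_case_limit_finite_positive
    (α qq γ : ℕ → ℝ)
    (hα : ∀ n, 2 ≤ n → 0 ≤ α n ∧ α n ≤ 1)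
    (hq : ∀ n, 2 ≤ n → 0 ≤ qq n ∧ qq n ≤ 1)
    (hp : ∀ n, 2 ≤ n → α n * (1 - qq n) < 1)
    (heq : ∀ n, 2 ≤ n → α n * (1 - qq n) = (Real.log n + γ n) / n)
    (hγ : Tendsto γ atTop atBot)
    (nk : ℕ → ℕ) (hmono : Monotone nk) (hnk : Tendsto nk atTop atTop)
    (hlim : ∃ L : ℝ, 0 < L ∧
      Tendsto (fun k => α (nk k) * Real.log (nk k)) atTop (nhds L)) :
    Tendsto (fun k => qq (nk k)) atTop (nhds 1) ∧
    Tendsto (fun k =>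
        (1 - qq (nk k)) *
          Real.exp (α (nk k) * Real.log (nk k)
            / (1 - α (nk k) * (1 - qq (nk k))) ^ 2)) atTop (nhds 0) ∧
    Tendsto (fun k =>
        qq (nk k) + (1 - qq (nk k)) *
          Real.exp (α (nk k) * Real.log (nk k)
            / (1 - α (nk k) * (1 - qq (nk k))) ^ 2)) atTop (nhds 1) := by
  obtain ⟨L, hL, hlim⟩ := hlim
  have hcast : Tendsto (fun k => ((nk k : ℕ) : ℝ)) atTop atTop :=
    tendsto_natCast_atTop_atTop.comp hnk
  have hlog : Tendsto (fun k => Real.log (nk k) ^ 2 / (nk k : ℝ)) atTop (nhds 0) :=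
    ((Real.isLittleO_pow_log_id_atTop (n := 2)).tendsto_div_nhds_zero).comp hcast
  have h2 : ∀ᶠ k in atTop, 2 ≤ nk k := hnk.eventually_ge_atTop 2
  have hg : ∀ᶠ k in atTop, γ (nk k) ≤ 0 := (hγ.comp hnk).eventually_le_atBot 0
  have h1 : Tendsto (fun k => (1 - qq (nk k)) * (α (nk k) * Real.log (nk k)))
      atTop (nhds 0) := by
    refine tendsto_of_tendsto_of_tendsto_of_le_of_le' tendsto_const_nhds hlog ?_ ?_
    · filter_upwards [h2] with k hk
      have hl : 0 ≤ Real.log (nk k) := Real.log_natCast_nonneg _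
      exact mul_nonneg (by linarith [(hq _ hk).2]) (mul_nonneg (hα _ hk).1 hl)
    · filter_upwards [h2, hg] with k hk hgk
      have hl : 0 ≤ Real.log (nk k) := Real.log_natCast_nonneg _
      have hn : (0 : ℝ) < nk k := by exact_mod_cast (by omega : 0 < nk k)
      calc (1 - qq (nk k)) * (α (nk k) * Real.log (nk k))
          = (α (nk k) * (1 - qq (nk k))) * Real.log (nk k) := by ring
        _ = (Real.log (nk k) + γ (nk k)) / nk k * Real.log (nk k) := by rw [heq _ hk]
        _ ≤ Real.log (nk k) / nk k * Real.log (nk k) := by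
            gcongr
            linarith
        _ = Real.log (nk k) ^ 2 / (nk k : ℝ) := by ring
  have hq1 : Tendsto (fun k => 1 - qq (nk k)) atTop (nhds 0) := by
    have h := h1.div hlim hL.ne'
    rw [zero_div] at h
    refine h.congr' ?_
    filter_upwards [hlim.eventually_ne hL.ne'] with k hk
    exact mul_div_cancel_right₀ _ hk
  have hqq : Tendsto (fun k => qq (nk k)) atTop (nhds 1) := by
    simpa using (tendsto_const_nhds (x := (1 : ℝ))).sub hq1
  have hp0 : Tendsto (fun k => α (nk k) * (1 - qq (nk k))) atTop (nhds 0) := by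
    refine tendsto_of_tendsto_of_tendsto_of_le_of_le' tendsto_const_nhds hq1 ?_ ?_
    · filter_upwards [h2] with k hk
      exact mul_nonneg (hα _ hk).1 (by linarith [(hq _ hk).2])
    · filter_upwards [h2] with k hk
      exact mul_le_of_le_one_left (by linarith [(hq _ hk).2]) (hα _ hk).2
  have hden : Tendsto (fun k => (1 - α (nk k) * (1 - qq (nk k))) ^ 2) atTop (nhds 1) := by
    simpa using ((tendsto_const_nhds (x := (1 : ℝ))).sub hp0).pow 2
  have hR := (Real.continuous_exp.tendsto _).comp (hlim.div hden one_ne_zero)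
  have hprod : Tendsto (fun k => (1 - qq (nk k)) *
      Real.exp (α (nk k) * Real.log (nk k)
        / (1 - α (nk k) * (1 - qq (nk k))) ^ 2)) atTop (nhds 0) := by
    have h := hq1.mul hR
    rw [zero_mul] at h
    exact h
  refine ⟨hqq, hprod, ?_⟩
  have h := hqq.add hprod
  rw [add_zero] at h
  exact h
end

section
/- Let α_n ∈ [0,1] and q_n ∈ [0,1] (n ≥ 2) be sequences such that p_n := α_n(1 − q_n) = (log n + γ_n)/n for all n, where γ_n is a real sequence with lim_{n→∞} γ_n = −∞. Define R°_n = exp(α_n (log n)/(1 − p_n)²). If k ↦ n_k is a nondecreasing subsequence with n_k → ∞ along which lim_{k→∞} α_{n_k} log n_k = ∞, then lim_{k→∞} q_{n_k} = 1; if in addition limsup_{k→∞} α_{n_k} < 1, then also lim_{k→∞} (1 − q_{n_k}) R°_{n_k} = 0 and lim_{k→∞} (q_{n_k} + (1 − q_{n_k}) R°_{n_k}) = 1. -/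
open Filter

/-- Lemma 4: suppose `p_n := α_n (1 - q_n) = (log n + γ_n)/n` with `γ_n → -∞`, and
let `R°_n = exp(α_n log n/(1-p_n)²)`.  Along any nondecreasing subsequence
`k ↦ n_k → ∞` with `α_{n_k} log n_k → ∞`, one has `q_{n_k} → 1`; if in addition
`limsup_k α_{n_k} < 1`, then also `(1 - q_{n_k}) R°_{n_k} → 0` and
`q_{n_k} + (1 - q_{n_k}) R°_{n_k} → 1`. -/
theorem subseq_case_limit_infinite
    (α qq γ : ℕ → ℝ)
    (hα : ∀ n, 2 ≤ n → 0 ≤ α n ∧ α n ≤ 1)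
    (hq : ∀ n, 2 ≤ n → 0 ≤ qq n ∧ qq n ≤ 1)
    (hp : ∀ n, 2 ≤ n → α n * (1 - qq n) < 1)
    (heq : ∀ n, 2 ≤ n → α n * (1 - qq n) = (Real.log n + γ n) / n)
    (hγ : Tendsto γ atTop atBot)
    (nk : ℕ → ℕ) (hmono : Monotone nk) (hnk : Tendsto nk atTop atTop)
    (hlim : Tendsto (fun k => α (nk k) * Real.log (nk k)) atTop atTop) :
    Tendsto (fun k => qq (nk k)) atTop (nhds 1) ∧
    (limsup (fun k => α (nk k)) atTop < 1 →
      Tendsto (fun k =>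
          (1 - qq (nk k)) *
            Real.exp (α (nk k) * Real.log (nk k)
              / (1 - α (nk k) * (1 - qq (nk k))) ^ 2)) atTop (nhds 0) ∧
      Tendsto (fun k =>
          qq (nk k) + (1 - qq (nk k)) *
            Real.exp (α (nk k) * Real.log (nk k)
              / (1 - α (nk k) * (1 - qq (nk k))) ^ 2)) atTop (nhds 1)) := by
  have hnR : Tendsto (fun k => (nk k : ℝ)) atTop atTop :=
    tendsto_natCast_atTop_atTop.comp hnk
  have hL : Tendsto (fun k => Real.log (nk k)) atTop atTop :=
    Real.tendsto_log_atTop.comp hnR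
  have hbase : ∀ᶠ k in atTop, 2 ≤ nk k := hnk.eventually_ge_atTop 2
  have hγ0 : ∀ᶠ k in atTop, γ (nk k) ≤ 0 := (hγ.comp hnk).eventually_le_atBot 0
  have hexp : ∀ k, 2 ≤ nk k → (nk k : ℝ) = Real.exp (Real.log (nk k)) := by
    intro k hk
    rw [Real.exp_log]
    exact_mod_cast (by omega : 0 < nk k)
  have hpb : ∀ᶠ k in atTop, α (nk k) * (1 - qq (nk k))
      ≤ Real.log (nk k) * Real.exp (-Real.log (nk k)) := by
    filter_upwards [hbase, hγ0] with k h2 h0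
    have hpos : (0 : ℝ) < nk k := by exact_mod_cast (by omega : 0 < nk k)
    rw [heq _ h2, Real.exp_neg, ← hexp k h2, ← div_eq_mul_inv]
    gcongr
    linarith
  have hqb : ∀ᶠ k in atTop, 1 - qq (nk k)
      ≤ Real.log (nk k) ^ 2 * Real.exp (-Real.log (nk k)) := by
    filter_upwards [hbase, hpb, hlim.eventually_ge_atTop 1, hL.eventually_ge_atTop 0]
      with k h2 hp1 h1 hL0
    have hq1 : 0 ≤ 1 - qq (nk k) := by linarith [(hq _ h2).2]
    have e1 := mul_le_mul_of_nonneg_right hp1 hL0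
    have e2 := mul_le_mul_of_nonneg_right h1 hq1
    nlinarith
  have hz1 : Tendsto (fun k => Real.log (nk k) * Real.exp (-Real.log (nk k))) atTop
      (nhds 0) := by
    have h := (Real.tendsto_pow_mul_exp_neg_atTop_nhds_zero 1).comp hL
    simpa [Function.comp_def] using h
  have hz2 : Tendsto (fun k => Real.log (nk k) ^ 2 * Real.exp (-Real.log (nk k))) atTop
      (nhds 0) :=
    (Real.tendsto_pow_mul_exp_neg_atTop_nhds_zero 2).comp hL
  have hq0 : Tendsto (fun k => 1 - qq (nk k)) atTop (nhds 0) := by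
    refine tendsto_of_tendsto_of_tendsto_of_le_of_le' tendsto_const_nhds hz2 ?_ hqb
    filter_upwards [hbase] with k h2
    linarith [(hq _ h2).2]
  have hp0 : Tendsto (fun k => α (nk k) * (1 - qq (nk k))) atTop (nhds 0) := by
    refine tendsto_of_tendsto_of_tendsto_of_le_of_le' tendsto_const_nhds hz1 ?_ hpb
    filter_upwards [hbase] with k h2
    exact mul_nonneg (hα _ h2).1 (by linarith [(hq _ h2).2])
  have hq1 : Tendsto (fun k => qq (nk k)) atTop (nhds 1) := by
    have h := hq0.const_sub 1
    simpa using h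
  refine ⟨hq1, fun hsup => ?_⟩
  obtain ⟨c, hc, hc1⟩ := exists_between hsup
  obtain ⟨d, hcd, hd1⟩ := exists_between hc1
  have hbdd : IsBoundedUnder (· ≤ ·) atTop (fun k => α (nk k)) := by
    refine ⟨1, ?_⟩
    rw [eventually_map]
    filter_upwards [hbase] with k h2
    exact (hα _ h2).2
  have hαc : ∀ᶠ k in atTop, α (nk k) < c := eventually_lt_of_limsup_lt hc hbdd
  have hdt : Tendsto (fun k => d * (1 - α (nk k) * (1 - qq (nk k))) ^ 2) atTop (nhds d) := by
    have h := ((hp0.const_sub 1).pow 2).const_mul d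
    simpa using h
  have hdc := hdt.eventually (lt_mem_nhds hcd)
  have hz3 : Tendsto (fun k => Real.log (nk k) ^ 2 * Real.exp (-(1 - d) * Real.log (nk k)))
      atTop (nhds 0) := by
    have h := (tendsto_rpow_mul_exp_neg_mul_atTop_nhds_zero 2 (1 - d) (by linarith)).comp hL
    simpa [Function.comp_def] using h
  have key : Tendsto (fun k =>
          (1 - qq (nk k)) *
            Real.exp (α (nk k) * Real.log (nk k)
              / (1 - α (nk k) * (1 - qq (nk k))) ^ 2)) atTop (nhds 0) := by
    refine tendsto_of_tendsto_of_tendsto_of_le_of_le' tendsto_const_nhds hz3 ?_ ?_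
    · filter_upwards [hbase] with k h2
      exact mul_nonneg (by linarith [(hq _ h2).2]) (Real.exp_pos _).le
    · filter_upwards [hbase, hqb, hαc, hdc, hL.eventually_ge_atTop 0] with k h2 hb h3 h4 hL0
      have hlt := hp _ h2
      have hpos : 0 < (1 - α (nk k) * (1 - qq (nk k))) ^ 2 := by
        have : 0 < 1 - α (nk k) * (1 - qq (nk k)) := by linarith
        positivity
      have hE : α (nk k) * Real.log (nk k) / (1 - α (nk k) * (1 - qq (nk k))) ^ 2
          ≤ d * Real.log (nk k) := by
        rw [div_le_iff₀ hpos]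
        have := mul_le_mul_of_nonneg_right (h3.trans h4).le hL0
        linarith
      calc _ ≤ (Real.log (nk k) ^ 2 * Real.exp (-Real.log (nk k)))
              * Real.exp (d * Real.log (nk k)) :=
            mul_le_mul hb (Real.exp_le_exp.2 hE) (Real.exp_pos _).le (by positivity)
        _ = _ := by
            rw [mul_assoc, ← Real.exp_add]
            congr 2
            ring
  refine ⟨key, ?_⟩
  have h := hq1.add key
  simpa using h
end
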